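/- Let v₁, v₂, v₃, v₄ be positive integers with gcd(v₁, v₂, v₃, v₄) = 1. If some two of the speeds share a common factor g > 3 (i.e., gcd(vᵢ, vⱼ) > 3 for some i ≠ j), then ML(v₁, v₂, v₃, v₄) ≥ 1/4. -/

import Mathlib

/-- `dnn x` is the distance from `x` to the nearest integer:
`dnn x = min_{m : ℤ} |x - m|`. -/
noncomputable def dnn (x : ℝ) : ℝ := ⨅ m : ℤ, |x - m|

/-- The maximum loneliness of speeds `v 0, …, v (n-1)`:
`ML v = sup_{t : ℝ} min_{i} dnn (t * v i)`. -/
noncomputable def ML {n : ℕ} (v : Fin n → ℝ) : ℝ := ⨆ t : ℝ, ⨅ i, dnn (t * v i)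

/-- `x` is at distance at least `1/4` from the integers. -/
def Far (x : ℝ) : Prop := ∃ m : ℤ, (m : ℝ) + 1 / 4 ≤ x ∧ x ≤ m + 3 / 4

/-- `x` is at distance at most `1/4` from the integers. -/
def Near (x : ℝ) : Prop := ∃ m : ℤ, (m : ℝ) - 1 / 4 ≤ x ∧ x ≤ m + 1 / 4

lemma Far.congr {x y : ℝ} (h : Far x) (n : ℤ) (e : y = x + n) : Far y := by
  obtain ⟨m, h1, h2⟩ := h
  refine ⟨m + n, ?_, ?_⟩ <;> push_cast <;> linarith

lemma Far.neg {x : ℝ} (h : Far x) : Far (-x) := by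
  obtain ⟨m, h1, h2⟩ := h
  refine ⟨-m - 1, ?_, ?_⟩ <;> push_cast <;> linarith

lemma Far.congr_neg {x y : ℝ} (h : Far x) (n : ℤ) (e : y = -x + n) : Far y :=
  h.neg.congr n e

lemma Near.congr {x y : ℝ} (h : Near x) (n : ℤ) (e : y = x + n) : Near y := by
  obtain ⟨m, h1, h2⟩ := h
  refine ⟨m + n, ?_, ?_⟩ <;> push_cast <;> linarith

lemma Near.neg {x : ℝ} (h : Near x) : Near (-x) := by
  obtain ⟨m, h1, h2⟩ := h
  refine ⟨-m, ?_, ?_⟩ <;> push_cast <;> linarith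

lemma far_base {x : ℝ} (h1 : 1 / 4 ≤ x) (h2 : x ≤ 3 / 4) : Far x :=
  ⟨0, by push_cast; linarith, by push_cast; linarith⟩

lemma near_base {x : ℝ} (h1 : -(1 / 4) ≤ x) (h2 : x ≤ 1 / 4) : Near x :=
  ⟨0, by push_cast; linarith, by push_cast; linarith⟩

lemma not_far {x : ℝ} (h : ¬ Far x) : ∃ m : ℤ, (m : ℝ) - 1 / 4 < x ∧ x < m + 1 / 4 := by
  by_contra hc
  push Not at hc
  apply h
  have h1 := Int.floor_le x
  have h2 := Int.lt_floor_add_one x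
  refine ⟨⌊x⌋, ?_, ?_⟩
  · exact hc ⌊x⌋ (by linarith)
  · by_contra h3
    have := hc (⌊x⌋ + 1) (by push_cast; linarith)
    push_cast at this
    linarith

lemma far_interval (y z : ℝ) (h : y + 1 / 2 ≤ z) : ∃ s, y ≤ s ∧ s ≤ z ∧ Far s := by
  by_cases hy : Far y
  · exact ⟨y, le_refl _, by linarith, hy⟩
  · obtain ⟨m, h1, h2⟩ := not_far hy
    exact ⟨m + 1 / 4, by linarith, by linarith, m, by linarith, by linarith⟩

lemma near_interval (y z : ℝ) (h : y + 1 / 2 ≤ z) : ∃ s, y ≤ s ∧ s ≤ z ∧ Near s := by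
  obtain ⟨s, h1, h2, m, h3, h4⟩ := far_interval (y + 1 / 2) (z + 1 / 2) (by linarith)
  exact ⟨s - 1 / 2, by linarith, by linarith, m, by linarith, by linarith⟩

lemma far_time (t₁ t₂ n : ℝ) (hn : 0 < n) (h : 1 / 2 ≤ n * (t₂ - t₁)) :
    ∃ t, t₁ ≤ t ∧ t ≤ t₂ ∧ Far (t * n) := by
  obtain ⟨s, h1, h2, h3⟩ := far_interval (t₁ * n) (t₂ * n) (by linarith)
  refine ⟨s / n, ?_, ?_, ?_⟩
  · rwa [le_div_iff₀ hn]
  · rwa [div_le_iff₀ hn]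
  · rwa [div_mul_cancel₀ _ hn.ne']

lemma near_time (t₁ t₂ n : ℝ) (hn : 0 < n) (h : 1 / 2 ≤ n * (t₂ - t₁)) :
    ∃ t, t₁ ≤ t ∧ t ≤ t₂ ∧ Near (t * n) := by
  obtain ⟨s, h1, h2, h3⟩ := near_interval (t₁ * n) (t₂ * n) (by linarith)
  refine ⟨s / n, ?_, ?_, ?_⟩
  · rwa [le_div_iff₀ hn]
  · rwa [div_le_iff₀ hn]
  · rwa [div_mul_cancel₀ _ hn.ne']

lemma far_of_window (t a : ℝ) (ha : 0 < a) (h1 : 1 / (4 * a) ≤ t) (h2 : t ≤ 3 / (4 * a)) :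
    Far (t * a) := by
  rw [div_le_iff₀ (by positivity)] at h1
  rw [le_div_iff₀ (by positivity)] at h2
  exact far_base (by linarith) (by linarith)

/-- Two speeds. -/
lemma two_far_aux (a b : ℤ) (ha : 0 < a) (hab : a ≤ b) :
    ∃ t : ℝ, Far (t * a) ∧ Far (t * b) := by
  have ha' : (0 : ℝ) < a := by exact_mod_cast ha
  have hab' : (a : ℝ) ≤ b := by exact_mod_cast hab
  obtain ⟨t, h1, h2, h3⟩ := far_time (1 / (4 * a)) (3 / (4 * a)) b (by linarith) (by
    have : (b : ℝ) * (3 / (4 * a) - 1 / (4 * a)) = b / (2 * a) := by field_simp; ring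
    rw [this, div_le_div_iff₀ (by norm_num) (by positivity)]
    linarith)
  exact ⟨t, far_of_window t a ha' h1 h2, h3⟩

lemma two_far (a b : ℤ) (ha : 0 < a) (hb : 0 < b) :
    ∃ t : ℝ, Far (t * a) ∧ Far (t * b) := by
  rcases le_total a b with h | h
  · exact two_far_aux a b ha h
  · obtain ⟨t, h1, h2⟩ := two_far_aux b a hb h
    exact ⟨t, h2, h1⟩

lemma far_near (a w : ℤ) (ha : 0 < a) (hw : 0 ≤ w) :
    ∃ t : ℝ, Far (t * a) ∧ Near (t * w) := by
  have ha' : (0 : ℝ) < a := by exact_mod_cast ha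
  rcases le_total w a with h | h
  · have h' : (w : ℝ) ≤ a := by exact_mod_cast h
    have hw' : (0 : ℝ) ≤ w := by exact_mod_cast hw
    refine ⟨1 / (4 * a), far_of_window _ a ha' le_rfl ?_, near_base ?_ ?_⟩
    · gcongr; norm_num
    · have : (0 : ℝ) ≤ 1 / (4 * a) * w := by positivity
      linarith
    · rw [div_mul_eq_mul_div, div_le_div_iff₀ (by positivity) (by norm_num)]
      linarith
  · have h' : (a : ℝ) ≤ w := by exact_mod_cast h
    obtain ⟨t, h1, h2, h3⟩ := near_time (1 / (4 * a)) (3 / (4 * a)) w (by linarith) (by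
      have : (w : ℝ) * (3 / (4 * a) - 1 / (4 * a)) = w / (2 * a) := by field_simp; ring
      rw [this, div_le_div_iff₀ (by norm_num) (by positivity)]
      linarith)
    exact ⟨t, far_of_window t a ha' h1 h2, h3⟩

/-- Grid points in intervals. -/
lemma grid (g : ℤ) (hg : 0 < g) (x l r : ℝ) (h : l + 1 / g ≤ r) :
    ∃ j : ℤ, l ≤ x + j / g ∧ x + j / g ≤ r := by
  have hg' : (0 : ℝ) < g := by exact_mod_cast hg
  refine ⟨⌈g * (l - x)⌉, ?_, ?_⟩
  · have := Int.le_ceil ((g : ℝ) * (l - x))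
    have : l - x ≤ ⌈g * (l - x)⌉ / g := by
      rw [le_div_iff₀ hg']; linarith
    linarith
  · have := Int.ceil_lt_add_one ((g : ℝ) * (l - x))
    have : (⌈g * (l - x)⌉ : ℝ) / g ≤ (l - x) + 1 / g := by
      rw [div_le_iff₀ hg', add_mul, div_mul_cancel₀ _ hg'.ne']; linarith
    linarith

lemma shift (g u : ℤ) (hg : 2 ≤ g) (hu : IsCoprime u g) (y : ℝ) :
    ∃ k : ℤ, Far (y + u * k / g) := by
  have hg' : (2 : ℝ) ≤ g := by exact_mod_cast hg
  have hg0 : (g : ℝ) ≠ 0 := by linarith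
  obtain ⟨j, h1, h2⟩ := grid g (by omega) y (1 / 4) (3 / 4) (by
    have : (1 : ℝ) / g ≤ 1 / 2 := by gcongr
    linarith)
  obtain ⟨s, r, e⟩ := hu
  have e' : (s : ℝ) * u + r * g = 1 := by exact_mod_cast e
  refine ⟨s * j, (far_base h1 h2).congr (-r * j) ?_⟩
  push_cast
  field_simp
  linear_combination (j : ℝ) * e'

lemma run_aux (z δ : ℝ) (hδ : |δ| ≤ 1 / 2) (n : ℕ) (h : ∀ i : ℕ, i ≤ n → ¬ Far (z + i * δ)) :
    ∃ m : ℤ, (m - 1 / 4 < z ∧ z < m + 1 / 4) ∧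
      ((m : ℝ) - 1 / 4 < z + n * δ ∧ z + n * δ < m + 1 / 4) := by
  obtain ⟨hd1, hd2⟩ := abs_le.mp hδ
  induction n with
  | zero =>
    obtain ⟨m, h1, h2⟩ := not_far (h 0 le_rfl)
    refine ⟨m, ?_, h1, h2⟩
    simp at h1 h2
    constructor <;> linarith
  | succ n ih =>
    obtain ⟨m, h0, h1, h2⟩ := ih (fun i hi => h i (by omega))
    obtain ⟨m', h3, h4⟩ := not_far (h (n + 1) le_rfl)
    have : m = m' := by
      push_cast at h3 h4
      have ha : (m : ℝ) < m' + 1 := by linarith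
      have hb : (m' : ℝ) < m + 1 := by linarith
      have ha' : m < m' + 1 := by exact_mod_cast ha
      have hb' : m' < m + 1 := by exact_mod_cast hb
      omega
    subst this
    exact ⟨m, h0, h3, h4⟩

lemma claimC (g c : ℤ) (hg : 4 ≤ g) (x y : ℝ) (h5 : g ≠ 5 ∨ Far (g * x))
    (hc0 : ¬ g ∣ c) (hc1 : ¬ g ∣ c - 1) (hc2 : ¬ g ∣ c + 1) :
    ∃ j : ℤ, Far (x + j / g) ∧ Far (y + c * j / g) := by
  have hg' : (4 : ℝ) ≤ g := by exact_mod_cast hg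
  have hg0 : (g : ℝ) ≠ 0 := by linarith
  have hgp : (0 : ℝ) < g := by linarith
  obtain ⟨c', q, e, hc3, hc4⟩ : ∃ c' q : ℤ, c = c' + g * q ∧ 2 ≤ |c'| ∧ 2 * |c'| ≤ g := by
    have key : ∃ c' q : ℤ, c = c' + g * q ∧ 2 * |c'| ≤ g := by
      have h1 := Int.emod_nonneg c (show g ≠ 0 by omega)
      have h2 := Int.emod_lt_of_pos c (show 0 < g by omega)
      have h3 := Int.emod_add_mul_ediv c g
      by_cases h : 2 * (c % g) ≤ g
      · exact ⟨c % g, c / g, h3.symm, by rwa [abs_of_nonneg h1]⟩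
      · refine ⟨c % g - g, c / g + 1, by linarith, ?_⟩
        rw [abs_of_neg (by omega)]; omega
    obtain ⟨c', q, e, h⟩ := key
    refine ⟨c', q, e, ?_, h⟩
    by_contra hlt
    have : c' = 0 ∨ c' = 1 ∨ c' = -1 := by
      have := abs_lt.mp (show |c'| < 2 by omega)
      omega
    rcases this with rfl | rfl | rfl
    · exact hc0 ⟨q, by linarith⟩
    · exact hc1 ⟨q, by linarith⟩
    · exact hc2 ⟨q, by linarith⟩
  obtain ⟨n, j0, hn, hrun⟩ : ∃ (n : ℕ) (j0 : ℤ), g ≤ 4 * (n : ℤ) ∧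
      ∀ i : ℕ, i ≤ n → Far (x + (j0 + i : ℤ) / g) := by
    by_cases hh : g = 5
    · subst hh
      obtain ⟨m, h1, h2⟩ := h5.resolve_left (by simp)
      push_cast at h1 h2
      refine ⟨2, 1 - m, by norm_num, fun i hi => far_base ?_ ?_⟩
      · have : (0 : ℝ) ≤ i := by positivity
        push_cast; linarith
      · have : (i : ℝ) ≤ 2 := by exact_mod_cast hi
        push_cast; linarith
    · obtain ⟨j, h1, h2⟩ := grid g (by omega) x (1 / 4) (1 / 4 + 1 / g) le_rfl
      refine ⟨(g / 2 - 1).toNat, j, by omega, fun i hi => far_base ?_ ?_⟩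
      · have : (0 : ℝ) ≤ (i : ℝ) / g := by positivity
        push_cast; rw [add_div]; linarith
      · have : 2 * ((i : ℤ) + 1) ≤ g := by omega
        have : 2 * ((i : ℝ) + 1) ≤ g := by exact_mod_cast this
        have : (i : ℝ) / g ≤ 1 / 2 - 1 / g := by
          rw [div_le_iff₀ hgp, sub_mul, div_mul_cancel₀ _ hg0]; linarith
        push_cast; rw [add_div]; linarith
  by_contra hcon
  push Not at hcon
  have hc4' : 2 * |(c' : ℝ)| ≤ g := by exact_mod_cast hc4
  have hc3' : 2 ≤ |(c' : ℝ)| := by exact_mod_cast hc3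
  have hn' : (g : ℝ) ≤ 4 * n := by exact_mod_cast hn
  obtain ⟨m, ⟨h1, h2⟩, h3, h4⟩ := run_aux (y + c' * j0 / g) (c' / g) (by
      rw [abs_div, abs_of_pos hgp, div_le_iff₀ hgp]; linarith) n (by
    intro i hi hfar
    refine hcon _ (hrun i hi) (hfar.congr (q * (j0 + i)) ?_)
    rw [e]; push_cast; field_simp; ring)
  have h5 : |(n : ℝ) * (c' / g)| < 1 / 2 := by
    rw [abs_lt]; constructor <;> linarith
  rw [abs_mul, abs_div, abs_of_pos hgp, Nat.abs_cast, mul_div_assoc', div_lt_iff₀ hgp] at h5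
  nlinarith

lemma claimC2 (g u p : ℤ) (hg : 4 ≤ g) (hu : IsCoprime u g) (hp : ¬ g ∣ p)
    (h1 : ¬ g ∣ p - u) (h2 : ¬ g ∣ p + u) (x y : ℝ) (h5 : g ≠ 5 ∨ Far (g * x)) :
    ∃ k : ℤ, Far (x + u * k / g) ∧ Far (y + p * k / g) := by
  have hg' : (4 : ℝ) ≤ g := by exact_mod_cast hg
  have hg0 : (g : ℝ) ≠ 0 := by linarith
  obtain ⟨s, r, e⟩ := hu
  have e' : (s : ℝ) * u + r * g = 1 := by exact_mod_cast e
  have n1 : ¬ g ∣ p * s := by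
    rintro ⟨l, h⟩
    exact hp ⟨l * u + p * r, by linear_combination u * h - p * e⟩
  have n2 : ¬ g ∣ p * s - 1 := by
    rintro ⟨l, h⟩
    exact h1 ⟨l * u + p * r, by linear_combination u * h - p * e⟩
  have n3 : ¬ g ∣ p * s + 1 := by
    rintro ⟨l, h⟩
    exact h2 ⟨l * u + p * r, by linear_combination u * h - p * e⟩
  obtain ⟨j, h3, h4⟩ := claimC g (p * s) hg x y h5 n1 n2 n3
  refine ⟨s * j, h3.congr (-r * j) ?_, h4.congr 0 ?_⟩
  · push_cast
    field_simp
    linear_combination (j : ℝ) * e'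
  · push_cast
    ring

lemma isCoprime_of {x y : ℤ} (h : ∀ d : ℤ, d ∣ x → d ∣ y → IsUnit d) : IsCoprime x y :=
  isRelPrime_iff_isCoprime.mp (fun d h1 h2 => h d h1 h2)

/-- Two speeds with a common factor, plus a third. -/
lemma pair_shift (d a b c : ℤ) (hd : 2 ≤ d) (ha : 0 < a) (hb : 0 < b) (hc : IsCoprime c d) :
    ∃ t : ℝ, Far (t * (d * a : ℤ)) ∧ Far (t * (d * b : ℤ)) ∧ Far (t * c) := by
  have hd' : (2 : ℝ) ≤ d := by exact_mod_cast hd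
  have hd0 : (d : ℝ) ≠ 0 := by linarith
  obtain ⟨t, h1, h2⟩ := two_far a b ha hb
  obtain ⟨k, h3⟩ := shift d c hd hc (t / d * c)
  refine ⟨(t + k) / d, h1.congr (k * a) ?_, h2.congr (k * b) ?_, h3.congr 0 ?_⟩ <;>
  · push_cast; field_simp; try ring

lemma lr3_core (a b c : ℤ) (ha : 0 < a) (hc : 0 < c) (hab : a ≤ b)
    (hoa : a % 2 = 1) (hob : b % 2 = 1) (hec : c % 2 = 0) (hco : IsCoprime a b) :
    ∃ t : ℝ, Far (t * a) ∧ Far (t * b) ∧ Far (t * c) := by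
  have ha' : (0 : ℝ) < a := by exact_mod_cast ha
  have hab' : (a : ℝ) ≤ b := by exact_mod_cast hab
  have hb' : (0 : ℝ) < b := by linarith
  by_cases hbc : b ≤ c
  · have hbc' : (b : ℝ) ≤ c := by exact_mod_cast hbc
    obtain ⟨t, h1, h2, h3⟩ := far_time (1 / 2 - 1 / (4 * b)) (1 / 2 + 1 / (4 * b)) c (by linarith) (by
      have : (c : ℝ) * ((1 / 2 + 1 / (4 * b)) - (1 / 2 - 1 / (4 * b))) = c / (2 * b) := by
        field_simp; ring
      rw [this, div_le_div_iff₀ (by norm_num) (by positivity)]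
      linarith)
    have hs : ∃ s : ℝ, t = 1 / 2 + s ∧ |s| * (4 * b) ≤ 1 := by
      refine ⟨t - 1 / 2, by ring, ?_⟩
      rw [← le_div_iff₀ (by positivity), abs_le]
      constructor <;> linarith
    obtain ⟨s, rfl, hs⟩ := hs
    have key : ∀ n : ℤ, 0 < n → n ≤ b → n % 2 = 1 → Far ((1 / 2 + s) * n) := by
      intro n hn hnb hodd
      have hn' : (0 : ℝ) < n := by exact_mod_cast hn
      have hnb' : (n : ℝ) ≤ b := by exact_mod_cast hnb
      have h5 : |s * n| ≤ 1 / 4 := by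
        rw [abs_mul, abs_of_pos hn']
        have : |s| * n ≤ |s| * b := by gcongr
        linarith
      obtain ⟨h6, h7⟩ := abs_le.mp h5
      obtain ⟨q, hq⟩ : ∃ q : ℤ, n = 2 * q + 1 := ⟨n / 2, by omega⟩
      refine ⟨q, ?_, ?_⟩
      · have : (n : ℝ) = 2 * q + 1 := by exact_mod_cast hq
        linarith
      · have : (n : ℝ) = 2 * q + 1 := by exact_mod_cast hq
        linarith
    exact ⟨_, key a ha hab hoa, key b (by omega) le_rfl hob, h3⟩
  · have hm : (4 : ℤ) ≤ a + b := by omega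
    have hm' : (4 : ℝ) ≤ (a : ℝ) + b := by exact_mod_cast hm
    have hm0 : (a : ℝ) + b ≠ 0 := by linarith
    obtain ⟨k, h1, h2⟩ := claimC2 (a + b) a c hm
      (by obtain ⟨s, r, e⟩ := hco; exact ⟨s - r, r, by linarith⟩)
      (fun h => by have := Int.le_of_dvd hc h; omega)
      (fun h => by
        have : (2 : ℤ) ∣ c - a := dvd_trans (by omega) h
        omega)
      (fun h => by
        have : (2 : ℤ) ∣ c + a := dvd_trans (by omega) h
        omega) 0 0 (Or.inl (by omega))
    push_cast at h1 h2
    refine ⟨k / (a + b), h1.congr 0 ?_, h1.congr_neg k ?_, h2.congr 0 ?_⟩ <;>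
    · push_cast; field_simp; try ring

lemma lr3_core' (a b c : ℤ) (ha : 0 < a) (hb : 0 < b) (hc : 0 < c)
    (hoa : a % 2 = 1) (hob : b % 2 = 1) (hec : c % 2 = 0) (hco : IsCoprime a b) :
    ∃ t : ℝ, Far (t * a) ∧ Far (t * b) ∧ Far (t * c) := by
  rcases le_total a b with h | h
  · exact lr3_core a b c ha hc h hoa hob hec hco
  · obtain ⟨t, h1, h2, h3⟩ := lr3_core b a c hb hc h hob hoa hec hco.symm
    exact ⟨t, h2, h1, h3⟩

lemma pair_shift' (a b c : ℤ) (ha : 0 < a) (hb : 0 < b)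
    (H : ∀ d : ℤ, d ∣ a → d ∣ b → d ∣ c → IsUnit d) (hn : ¬ IsCoprime a b) :
    ∃ t : ℝ, Far (t * a) ∧ Far (t * b) ∧ Far (t * c) := by
  obtain ⟨a', ha'⟩ := Int.gcd_dvd_left a b
  obtain ⟨b', hb'⟩ := Int.gcd_dvd_right a b
  have h0 : 0 < Int.gcd a b := Int.gcd_pos_of_ne_zero_left _ ha.ne'
  have h1 : Int.gcd a b ≠ 1 := fun h => hn (Int.isCoprime_iff_gcd_eq_one.mpr h)
  have hco : IsCoprime c (Int.gcd a b : ℤ) := isCoprime_of fun d h2 h3 =>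
    H d (h3.trans (Int.gcd_dvd_left a b)) (h3.trans (Int.gcd_dvd_right a b)) h2
  generalize (Int.gcd a b) = d at *
  have hd : (0 : ℤ) < d := by exact_mod_cast h0
  obtain ⟨t, ht⟩ := pair_shift d a' b' c (by omega)
    (by rw [ha'] at ha; exact pos_of_mul_pos_right ha hd.le)
    (by rw [hb'] at hb; exact pos_of_mul_pos_right hb hd.le) hco
  rw [← ha', ← hb'] at ht
  exact ⟨t, ht⟩

lemma lr3_cop (a b c : ℤ) (ha : 0 < a) (hb : 0 < b) (hc : 0 < c)
    (H : ∀ d : ℤ, d ∣ a → d ∣ b → d ∣ c → IsUnit d) :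
    ∃ t : ℝ, Far (t * a) ∧ Far (t * b) ∧ Far (t * c) := by
  by_cases h1 : IsCoprime a b
  swap
  · exact pair_shift' a b c ha hb H h1
  by_cases h2 : IsCoprime a c
  swap
  · obtain ⟨t, h3, h4, h5⟩ := pair_shift' a c b ha hc (fun d x y z => H d x z y) h2
    exact ⟨t, h3, h5, h4⟩
  by_cases h3 : IsCoprime b c
  swap
  · obtain ⟨t, h3, h4, h5⟩ := pair_shift' b c a hb hc (fun d x y z => H d z x y) h3
    exact ⟨t, h5, h3, h4⟩
  have npar : ∀ x y : ℤ, IsCoprime x y → ¬ (x % 2 = 0 ∧ y % 2 = 0) := by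
    rintro x y h ⟨hx, hy⟩
    have := h.isUnit_of_dvd' (x := 2) (by omega) (by omega)
    rw [Int.isUnit_iff] at this
    omega
  have q1 := npar a b h1
  have q2 := npar a c h2
  have q3 := npar b c h3
  rcases Int.emod_two_eq_zero_or_one a with ea | ea
  · obtain ⟨t, x, y, z⟩ := lr3_core' b c a hb hc ha (by omega) (by omega) ea h3
    exact ⟨t, z, x, y⟩
  rcases Int.emod_two_eq_zero_or_one b with eb | eb
  · obtain ⟨t, x, y, z⟩ := lr3_core' a c b ha hc hb (by omega) (by omega) eb h2
    exact ⟨t, x, z, y⟩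
  rcases Int.emod_two_eq_zero_or_one c with ec | ec
  · exact lr3_core' a b c ha hb hc (by omega) (by omega) ec h1
  have key : ∀ n : ℤ, n % 2 = 1 → Far (1 / 2 * n) := by
    intro n hodd
    obtain ⟨q, hq⟩ : ∃ q : ℤ, n = 2 * q + 1 := ⟨n / 2, by omega⟩
    have : (n : ℝ) = 2 * q + 1 := by exact_mod_cast hq
    exact ⟨q, by linarith, by linarith⟩
  exact ⟨1 / 2, key a ea, key b eb, key c ec⟩

/-- Three speeds. -/
lemma lr3 (a b c : ℤ) (ha : 0 < a) (hb : 0 < b) (hc : 0 < c) :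
    ∃ t : ℝ, Far (t * a) ∧ Far (t * b) ∧ Far (t * c) := by
  set g : ℤ := (Int.gcd (Int.gcd a b : ℤ) c : ℤ) with hg
  have h0 : 0 < g := by
    have : 0 < Int.gcd (Int.gcd a b : ℤ) c := Int.gcd_pos_of_ne_zero_right _ hc.ne'
    omega
  have hga : g ∣ a := (Int.gcd_dvd_left _ _).trans (Int.gcd_dvd_left a b)
  have hgb : g ∣ b := (Int.gcd_dvd_left _ _).trans (Int.gcd_dvd_right a b)
  have hgc : g ∣ c := Int.gcd_dvd_right _ _
  have hmax : ∀ d : ℤ, d ∣ a → d ∣ b → d ∣ c → d ∣ g := fun d h1 h2 h3 =>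
    Int.dvd_coe_gcd (Int.dvd_coe_gcd h1 h2) h3
  clear_value g
  obtain ⟨a', rfl⟩ := hga
  obtain ⟨b', rfl⟩ := hgb
  obtain ⟨c', rfl⟩ := hgc
  obtain ⟨t, h1, h2, h3⟩ := lr3_cop a' b' c' (pos_of_mul_pos_right ha h0.le)
    (pos_of_mul_pos_right hb h0.le) (pos_of_mul_pos_right hc h0.le) (by
      intro d h1 h2 h3
      have := hmax (g * d) (mul_dvd_mul_left g h1) (mul_dvd_mul_left g h2) (mul_dvd_mul_left g h3)
      obtain ⟨l, hl⟩ := this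
      have : d * l = 1 := by
        have : g * (d * l) = g * 1 := by linarith
        exact mul_left_cancel₀ h0.ne' this
      exact IsUnit.of_mul_eq_one _ this)
  have hg0 : (g : ℝ) ≠ 0 := by exact_mod_cast h0.ne'
  refine ⟨t / g, h1.congr 0 ?_, h2.congr 0 ?_, h3.congr 0 ?_⟩ <;>
  · push_cast; field_simp; try ring

/-- Three speeds with a common factor, plus a fourth. -/
lemma triple_shift (d a b c p : ℤ) (hd : 2 ≤ d) (ha : 0 < a) (hb : 0 < b) (hc : 0 < c)
    (hp : IsCoprime p d) :
    ∃ t : ℝ, Far (t * (d * a : ℤ)) ∧ Far (t * (d * b : ℤ)) ∧ Far (t * (d * c : ℤ)) ∧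
      Far (t * p) := by
  have hd' : (2 : ℝ) ≤ d := by exact_mod_cast hd
  have hd0 : (d : ℝ) ≠ 0 := by linarith
  obtain ⟨t, h1, h2, h3⟩ := lr3 a b c ha hb hc
  obtain ⟨k, h4⟩ := shift d p hd hp (t / d * p)
  refine ⟨(t + k) / d, h1.congr (k * a) ?_, h2.congr (k * b) ?_, h3.congr (k * c) ?_,
    h4.congr 0 ?_⟩ <;>
  · push_cast; field_simp; try ring

lemma key_one (a b : ℤ) (ha : 0 < a) (hab : a ≤ b) (hco : IsCoprime a b) :
    (∃ t : ℝ, Far (t * a) ∧ Far (t * b) ∧ Near (t * (1 : ℤ))) ∨ (a = 1 ∧ (4 : ℤ) ∣ b) := by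
  have ha' : (0 : ℝ) < a := by exact_mod_cast ha
  have hab' : (a : ℝ) ≤ b := by exact_mod_cast hab
  by_cases h1 : a = 1
  · subst h1
    by_cases h4 : (4 : ℤ) ∣ b
    · exact Or.inr ⟨rfl, h4⟩
    · left
      refine ⟨1 / 4, far_base (by norm_num) (by norm_num), ?_, near_base (by norm_num) (by norm_num)⟩
      refine ⟨b / 4, ?_, ?_⟩
      · have : 4 * (b / 4) + 1 ≤ b := by omega
        have : (4 : ℝ) * (b / 4 : ℤ) + 1 ≤ b := by exact_mod_cast this
        linarith
      · have : b ≤ 4 * (b / 4) + 3 := by omega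
        have : (b : ℝ) ≤ 4 * (b / 4 : ℤ) + 3 := by exact_mod_cast this
        linarith
  left
  by_cases h2 : a = 2
  · subst h2
    by_cases h3 : b ≤ 3
    · have : b = 3 := by
        by_contra hb
        have : b = 2 := by omega
        subst this
        have := hco.isUnit_of_dvd' (x := 2) (by omega) (by omega)
        rw [Int.isUnit_iff] at this
        omega
      subst this
      exact ⟨1 / 8, far_base (by norm_num) (by norm_num), far_base (by norm_num) (by norm_num),
        near_base (by norm_num) (by norm_num)⟩
    · have hb : (4 : ℤ) ≤ b := by omega
      have hb' : (4 : ℝ) ≤ b := by exact_mod_cast hb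
      obtain ⟨t, x, y, z⟩ := far_time (1 / 8) (1 / 4) b (by linarith) (by linarith)
      exact ⟨t, far_base (by push_cast; linarith) (by push_cast; linarith), z,
        near_base (by push_cast; linarith) (by push_cast; linarith)⟩
  · have h3 : (3 : ℤ) ≤ a := by omega
    have h3' : (3 : ℝ) ≤ a := by exact_mod_cast h3
    obtain ⟨t, x, y, z⟩ := far_time (1 / (4 * a)) (3 / (4 * a)) b (by linarith) (by
      have : (b : ℝ) * (3 / (4 * a) - 1 / (4 * a)) = b / (2 * a) := by field_simp; ring
      rw [this, div_le_div_iff₀ (by norm_num) (by positivity)]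
      linarith)
    have h5 : (3 : ℝ) / (4 * a) ≤ 1 / 4 := by
      rw [div_le_div_iff₀ (by positivity) (by norm_num)]; linarith
    have h6 : (0 : ℝ) ≤ 1 / (4 * a) := by positivity
    exact ⟨t, far_of_window t a ha' x y, z,
        near_base (by push_cast; linarith) (by push_cast; linarith)⟩

lemma key_five (a b : ℤ) (ha : 0 < a) (hb : b ≠ 0) (hco : IsCoprime a 5)
    (h : (5 : ℤ) ∣ b - 2 * a) :
    ∃ t : ℝ, Far (t * a) ∧ Far (t * b) ∧ Near (t * (5 : ℤ)) := by
  have ha' : (1 : ℝ) ≤ a := by exact_mod_cast ha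
  have hb' : (b : ℝ) ≠ 0 := by exact_mod_cast hb
  have ha0 : (a : ℝ) ≠ 0 := by linarith
  obtain ⟨l, hl⟩ := h
  obtain ⟨k, r, e⟩ := hco
  have e' : (k : ℝ) * a + r * 5 = 1 := by exact_mod_cast e
  have hl' : (b : ℝ) - 2 * a = 5 * l := by exact_mod_cast hl
  by_cases hab : a ≤ |b|
  · have hab' : (a : ℝ) ≤ |(b : ℝ)| := by exact_mod_cast hab
    have hba : 1 ≤ |(b : ℝ)| := by linarith
    have q1 : |(a : ℝ) / b| ≤ 1 := by
      rw [abs_div, abs_of_pos (by linarith : (0 : ℝ) < a), div_le_one (by linarith)]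
      exact hab'
    have q2 : |(1 : ℝ) / b| ≤ 1 := by
      rw [abs_div, abs_one, div_le_one (by linarith)]
      exact hba
    obtain ⟨q3, q4⟩ := abs_le.mp q1
    obtain ⟨q5, q6⟩ := abs_le.mp q2
    refine ⟨2 * k / 5 - 1 / (20 * b), ?_, ?_, ?_⟩
    · refine Far.congr (x := 2 / 5 - (a / b) / 20) (far_base (by linarith) (by linarith))
        (-2 * r) ?_
      push_cast
      field_simp
      linear_combination (40 * (b : ℝ)) * e'
    · refine Far.congr (x := 3 / 4) (far_base (by norm_num) (by norm_num))
        (2 * k * l - 4 * r) ?_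
      push_cast
      field_simp
      linear_combination (320 : ℝ) * e' + 160 * (k : ℝ) * hl'
    · refine Near.congr (x := - (1 / b) / 4) (near_base (by linarith) (by linarith)) (2 * k) ?_
      push_cast
      field_simp
      ring
  · have hab' : |(b : ℝ)| ≤ a := by exact_mod_cast (not_le.mp hab).le
    have q1 : |(b : ℝ) / a| ≤ 1 := by
      rw [abs_div, abs_of_pos (by linarith : (0 : ℝ) < a), div_le_one (by linarith)]
      exact hab'
    have q5 : (1 : ℝ) / a ≤ 1 := by
      rw [div_le_one (by linarith)]
      exact ha'
    have q6 : 0 ≤ (1 : ℝ) / a := by positivity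
    obtain ⟨q3, q4⟩ := abs_le.mp q1
    refine ⟨k / 5 + 1 / (20 * a), ?_, ?_, ?_⟩
    · refine Far.congr (x := 1 / 4) (far_base (by linarith) (by linarith))
        (-r) ?_
      push_cast
      field_simp
      linear_combination (80 : ℝ) * e'
    · refine Far.congr (x := 2 / 5 + (b / a) / 20) (far_base (by linarith) (by linarith))
        (k * l - 2 * r) ?_
      push_cast
      field_simp
      linear_combination (40 * (a : ℝ)) * e' + 20 * (a : ℝ) * (k : ℝ) * hl'
    · refine Near.congr (x := (1 / a) / 4) (near_base (by linarith) (by linarith)) k ?_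
      push_cast
      field_simp
      ring

lemma key_common (a b w : ℤ) (ha : 0 < a) (hw : 0 < w) (hco : IsCoprime a b)
    (hn : ¬ IsCoprime a w) :
    ∃ t : ℝ, Far (t * a) ∧ Far (t * b) ∧ Near (t * w) := by
  obtain ⟨a', ha'⟩ := Int.gcd_dvd_left a w
  obtain ⟨w', hw'⟩ := Int.gcd_dvd_right a w
  have h0 : 0 < Int.gcd a w := Int.gcd_pos_of_ne_zero_left _ ha.ne'
  have h1 : Int.gcd a w ≠ 1 := fun h => hn (Int.isCoprime_iff_gcd_eq_one.mpr h)
  have hcd : IsCoprime b (Int.gcd a w : ℤ) := isCoprime_of fun d h2 h3 =>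
    hco.isUnit_of_dvd' (h3.trans (Int.gcd_dvd_left a w)) h2
  have hd : (0 : ℤ) < Int.gcd a w := by exact_mod_cast h0
  have hd2 : (2 : ℤ) ≤ Int.gcd a w := by omega
  generalize (Int.gcd a w : ℤ) = d at *
  have hd' : (2 : ℝ) ≤ d := by exact_mod_cast hd2
  have hd0 : (d : ℝ) ≠ 0 := by linarith
  subst ha' hw'
  obtain ⟨t, h2, h3⟩ := far_near a' w' (pos_of_mul_pos_right ha hd.le)
    (pos_of_mul_pos_right hw hd.le).le
  obtain ⟨k, h4⟩ := shift d b hd2 hcd (t / d * b)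
  refine ⟨(t + k) / d, h2.congr (k * a') ?_, h4.congr 0 ?_, h3.congr (k * w') ?_⟩ <;>
  · push_cast; field_simp; try ring

lemma key (a b w : ℤ) (ha : 0 < a) (hb : 0 < b) (hw : 0 ≤ w) (hco : IsCoprime a b) :
    (∃ t : ℝ, Far (t * a) ∧ Far (t * b) ∧ Near (t * w)) ∨
      (w = 1 ∧ ((a = 1 ∧ (4 : ℤ) ∣ b) ∨ (b = 1 ∧ (4 : ℤ) ∣ a))) := by
  by_cases hw0 : w = 0
  · left
    obtain ⟨t, h1, h2⟩ := two_far a b ha hb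
    exact ⟨t, h1, h2, near_base (by simp [hw0]) (by simp [hw0])⟩
  by_cases h1 : w = 1
  · subst h1
    rcases le_total a b with h | h
    · rcases key_one a b ha h hco with h | h
      · exact Or.inl h
      · exact Or.inr ⟨rfl, Or.inl h⟩
    · rcases key_one b a hb h hco.symm with ⟨t, x, y, z⟩ | h
      · exact Or.inl ⟨t, y, x, z⟩
      · exact Or.inr ⟨rfl, Or.inr h⟩
  left
  by_cases hca : IsCoprime a w
  swap
  · exact key_common a b w ha (by omega) hco hca
  by_cases hcb : IsCoprime b w
  swap
  · obtain ⟨t, x, y, z⟩ := key_common b a w hb (by omega) hco.symm hcb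
    exact ⟨t, y, x, z⟩
  have hw2 : 2 ≤ w := by omega
  have hw0' : (w : ℝ) ≠ 0 := by exact_mod_cast hw0
  have ndvd : ∀ x : ℤ, IsCoprime x w → ¬ w ∣ x := by
    intro x hx hd
    have := hx.isUnit_of_dvd' hd dvd_rfl
    rw [Int.isUnit_iff] at this
    omega
  have nearw : ∀ k : ℤ, Near (k / w * w : ℝ) := fun k => by
    refine Near.congr (x := 0) (near_base (by norm_num) (by norm_num)) k ?_
    field_simp; simp
  by_cases hm : w ∣ b - a
  · obtain ⟨l, hl⟩ := hm
    have hl' : (b : ℝ) - a = w * l := by exact_mod_cast hl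
    obtain ⟨k, hk⟩ := shift w a hw2 hca 0
    refine ⟨k / w, hk.congr 0 ?_, hk.congr (k * l) ?_, nearw k⟩
    · push_cast; ring
    · push_cast; field_simp; linear_combination (k : ℝ) * hl'
  by_cases hm' : w ∣ b + a
  · obtain ⟨l, hl⟩ := hm'
    have hl' : (b : ℝ) + a = w * l := by exact_mod_cast hl
    obtain ⟨k, hk⟩ := shift w a hw2 hca 0
    refine ⟨k / w, hk.congr 0 ?_, hk.congr_neg (k * l) ?_, nearw k⟩
    · push_cast; ring
    · push_cast; field_simp; linear_combination (k : ℝ) * hl'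
  have na := ndvd a hca
  have nb := ndvd b hcb
  by_cases h5 : w = 5
  · subst h5
    by_cases h6 : (5 : ℤ) ∣ b - 2 * a
    · exact key_five a b ha hb.ne' hca h6
    · have h7 : (5 : ℤ) ∣ -b - 2 * a := by
        have ca : a % 5 = 1 ∨ a % 5 = 2 ∨ a % 5 = 3 ∨ a % 5 = 4 := by omega
        have cb : b % 5 = 1 ∨ b % 5 = 2 ∨ b % 5 = 3 ∨ b % 5 = 4 := by omega
        rcases ca with ca | ca | ca | ca <;> rcases cb with cb | cb | cb | cb <;> omega
      obtain ⟨t, x, y, z⟩ := key_five a (-b) ha (by omega) hca h7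
      exact ⟨t, x, y.congr_neg 0 (by push_cast; ring), z⟩
  have hw4 : 4 ≤ w := by
    by_contra hlt
    have : w = 2 ∨ w = 3 := by omega
    rcases this with rfl | rfl
    · omega
    · have ca : a % 3 = 1 ∨ a % 3 = 2 := by omega
      have cb : b % 3 = 1 ∨ b % 3 = 2 := by omega
      rcases ca with ca | ca <;> rcases cb with cb | cb <;> omega
  obtain ⟨k, h6, h7⟩ := claimC2 w a b hw4 hca nb hm hm' 0 0 (Or.inl h5)
  refine ⟨k / w, h6.congr 0 ?_, h7.congr 0 ?_, nearw k⟩ <;>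
  · push_cast; ring

lemma exc_aux (g k u r j : ℤ) (hg : 4 ≤ g) (hk : 1 ≤ k) (hu : IsCoprime u g) (hr1 : 1 ≤ r)
    (hr3 : r ≤ 3) (h1 : 4 * k * g ≤ u * (4 * k + r) + 16 * k * j)
    (h2 : u * (4 * k + r) + 16 * k * j ≤ 8 * k * g - r * g) :
    ∃ t : ℝ, Far (t * g) ∧ Far (t * (g * (4 * k) : ℤ)) ∧ Far (t * u) ∧
      Far (t * (u + g : ℤ)) := by
  have hg' : (4 : ℝ) ≤ g := by exact_mod_cast hg
  have hk' : (1 : ℝ) ≤ k := by exact_mod_cast hk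
  have hr1' : (1 : ℝ) ≤ r := by exact_mod_cast hr1
  have hr3' : (r : ℝ) ≤ 3 := by exact_mod_cast hr3
  have h1' : (4 : ℝ) * k * g ≤ u * (4 * k + r) + 16 * k * j := by exact_mod_cast h1
  have h2' : (u : ℝ) * (4 * k + r) + 16 * k * j ≤ 8 * k * g - r * g := by exact_mod_cast h2
  have hg0 : (g : ℝ) ≠ 0 := by linarith
  have hk0 : (k : ℝ) ≠ 0 := by linarith
  have hkg : (0 : ℝ) < 16 * k * g := by positivity
  obtain ⟨s, q, e⟩ := hu
  have e' : (s : ℝ) * u + q * g = 1 := by exact_mod_cast e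
  obtain ⟨X, hX⟩ : ∃ X : ℝ, X = (u * (4 * k + r) + 16 * k * j) / (16 * k * g) := ⟨_, rfl⟩
  obtain ⟨T, hT⟩ : ∃ T : ℝ, T = (4 * k + r) / (16 * k) := ⟨_, rfl⟩
  have hX1 : 1 / 4 ≤ X := by
    rw [hX, le_div_iff₀ hkg]; linarith
  have hT1 : 1 / 4 ≤ T := by
    rw [hT, le_div_iff₀ (by positivity)]; linarith
  have hT2 : T ≤ 3 / 4 := by
    rw [hT, div_le_iff₀ (by positivity)]; linarith
  have hX2 : X + T ≤ 3 / 4 := by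
    have : X + T = (u * (4 * k + r) + 16 * k * j + g * (4 * k + r)) / (16 * k * g) := by
      rw [hX, hT]; field_simp
    rw [this, div_le_iff₀ hkg]; linarith
  refine ⟨(T + s * j) / g, ?_, ?_, ?_, ?_⟩
  · refine (far_base hT1 hT2).congr (s * j) ?_
    push_cast; field_simp
  · refine Far.congr (x := r / 4) (far_base (by linarith) (by linarith)) (k + s * j * (4 * k)) ?_
    rw [hT]; push_cast; field_simp; ring
  · refine (far_base hX1 (by linarith)).congr (-q * j) ?_
    rw [hX, hT]; push_cast; field_simp
    linear_combination (16 * k * j : ℝ) * e'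
  · refine (far_base (x := X + T) (by linarith) hX2).congr (-q * j + s * j) ?_
    rw [hX, hT]; push_cast; field_simp
    linear_combination (16 * k * j : ℝ) * e'

lemma exc (g k u : ℤ) (hg : 4 ≤ g) (hk : 1 ≤ k) (hu : IsCoprime u g) :
    ∃ t : ℝ, Far (t * g) ∧ Far (t * (g * (4 * k) : ℤ)) ∧ Far (t * u) ∧
      Far (t * (u + g : ℤ)) := by
  by_cases h4 : g = 4
  · subst h4
    have hodd : u % 2 = 1 := by
      by_contra h
      have := hu.isUnit_of_dvd' (x := 2) (by omega) (by omega)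
      rw [Int.isUnit_iff] at this
      omega
    by_contra hcon
    have bad : ∀ r : ℤ, 1 ≤ r → r ≤ 3 →
        ∃ q e : ℤ, u * (4 * k + r) = 16 * k * q - e ∧ 1 ≤ e ∧ e ≤ 4 * r - 1 := by
      intro r hr1 hr3
      have m1 := Int.emod_nonneg (u * (4 * k + r)) (show 16 * k ≠ 0 by omega)
      have m2 := Int.emod_lt_of_pos (u * (4 * k + r)) (show 0 < 16 * k by omega)
      have m3 := Int.emod_add_mul_ediv (u * (4 * k + r)) (16 * k)
      refine ⟨u * (4 * k + r) / (16 * k) + 1, 16 * k - u * (4 * k + r) % (16 * k), by linarith,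
        by omega, ?_⟩
      by_contra hlt
      apply hcon
      apply exc_aux 4 k u r (1 - u * (4 * k + r) / (16 * k)) hg hk hu hr1 hr3
      · linarith
      · linarith
    obtain ⟨q1, e1, a1, b1, c1⟩ := bad 1 (by norm_num) (by norm_num)
    obtain ⟨q2, e2, a2, b2, c2⟩ := bad 2 (by norm_num) (by norm_num)
    obtain ⟨q3, e3, a3, b3, c3⟩ := bad 3 (by norm_num) (by norm_num)
    obtain ⟨v, rfl⟩ : ∃ v, u = 2 * v + 1 := ⟨u / 2, by omega⟩
    have hk8 : k * (8 * (1 + 2 * v - 2 * (3 * q1 - q3))) = e3 - 3 * e1 := by linarith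
    have hk1 : k = 1 := by
      by_contra hne
      have hk2 : 2 ≤ k := by omega
      obtain ⟨z, hz⟩ : ∃ z, z = 1 + 2 * v - 2 * (3 * q1 - q3) := ⟨_, rfl⟩
      rw [← hz] at hk8
      rcases lt_trichotomy z 0 with h | h | h
      · nlinarith
      · omega
      · nlinarith
    subst hk1
    have cv : v % 8 = 0 ∨ v % 8 = 1 ∨ v % 8 = 2 ∨ v % 8 = 3 ∨ v % 8 = 4 ∨ v % 8 = 5 ∨
      v % 8 = 6 ∨ v % 8 = 7 := by omega
    rcases cv with h | h | h | h | h | h | h | h <;> omega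
  · have hg5 : 5 ≤ g := by omega
    have m1 := Int.emod_nonneg (u * (4 * k + 1) - 4 * k * g) (show 16 * k ≠ 0 by omega)
    have m2 := Int.emod_lt_of_pos (u * (4 * k + 1) - 4 * k * g) (show 0 < 16 * k by omega)
    have m3 := Int.emod_add_mul_ediv (u * (4 * k + 1) - 4 * k * g) (16 * k)
    apply exc_aux g k u 1 (-((u * (4 * k + 1) - 4 * k * g) / (16 * k))) hg hk hu le_rfl (by norm_num)
    · linarith
    · nlinarith

lemma main_one (g a b u w : ℤ) (hg : 4 ≤ g) (ha : 0 < a) (hb : 0 < b) (hw : 0 ≤ w)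
    (hco : IsCoprime a b) (hu : IsCoprime u g) :
    ∃ t : ℝ, Far (t * (g * a : ℤ)) ∧ Far (t * (g * b : ℤ)) ∧ Far (t * u) ∧
      Far (t * (u + g * w : ℤ)) := by
  rcases key a b w ha hb hw hco with ⟨t, h1, h2, m, h3, h4⟩ | ⟨rfl, ⟨rfl, k, rfl⟩ | ⟨rfl, k, rfl⟩⟩
  · have hg' : (4 : ℝ) ≤ g := by exact_mod_cast hg
    have hg0 : (g : ℝ) ≠ 0 := by linarith
    have hg1 : (1 : ℝ) / g ≤ 1 / 4 := by gcongr
    obtain ⟨j, h5, h6, h7, h8⟩ : ∃ j : ℤ, 1 / 4 ≤ t * u / g + j / g ∧ t * u / g + j / g ≤ 3 / 4 ∧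
        1 / 4 ≤ t * u / g + j / g + (t * w - m) ∧ t * u / g + j / g + (t * w - m) ≤ 3 / 4 := by
      rcases le_total (t * w - m) 0 with h | h
      · obtain ⟨j, h5, h6⟩ := grid g (by omega) (t * u / g) (1 / 2) (3 / 4) (by linarith)
        exact ⟨j, by linarith, by linarith, by linarith, by linarith⟩
      · obtain ⟨j, h5, h6⟩ := grid g (by omega) (t * u / g) (1 / 4) (1 / 2) (by linarith)
        exact ⟨j, by linarith, by linarith, by linarith, by linarith⟩
    obtain ⟨s, q, e⟩ := hu
    have e' : (s : ℝ) * u + q * g = 1 := by exact_mod_cast e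
    refine ⟨(t + s * j) / g, h1.congr (s * j * a) ?_, h2.congr (s * j * b) ?_,
      (far_base h5 h6).congr (-q * j) ?_, (far_base h7 h8).congr (-q * j + m + s * j * w) ?_⟩
    · push_cast; field_simp
    · push_cast; field_simp
    · push_cast; field_simp; linear_combination (j : ℝ) * e'
    · push_cast; field_simp; linear_combination (j : ℝ) * e'
  · obtain ⟨t, h1, h2, h3, h4⟩ := exc g k u hg (by omega) hu
    exact ⟨t, by simpa using h1, h2, h3, by simpa using h4⟩
  · obtain ⟨t, h1, h2, h3, h4⟩ := exc g k u hg (by omega) hu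
    exact ⟨t, h2, by simpa using h1, h3, by simpa using h4⟩

lemma main_two (g a b u p : ℤ) (hg : 4 ≤ g) (ha : 0 < a) (hb : 0 < b)
    (hco : IsCoprime a b) (hu : IsCoprime u g) (hp : IsCoprime p g) (h : g ∣ p - u) :
    ∃ t : ℝ, Far (t * (g * a : ℤ)) ∧ Far (t * (g * b : ℤ)) ∧ Far (t * u) ∧ Far (t * p) := by
  obtain ⟨w, hw⟩ := h
  rcases le_total 0 w with h0 | h0
  · have := main_one g a b u w hg ha hb h0 hco hu
    rwa [← hw, add_sub_cancel] at this
  · obtain ⟨t, h1, h2, h3, h4⟩ := main_one g a b p (-w) hg ha hb (by omega) hco hp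
    have e : p + g * -w = u := by linarith
    rw [e] at h4
    exact ⟨t, h1, h2, h4, h3⟩

lemma triple_shift' (g a b u p : ℤ) (hg : 4 ≤ g) (ha : 0 < a) (hb : 0 < b) (hup : 0 < u)
    (H : ∀ d : ℤ, d ∣ g → d ∣ u → d ∣ p → IsUnit d) (hu : ¬ IsCoprime u g) :
    ∃ t : ℝ, Far (t * (g * a : ℤ)) ∧ Far (t * (g * b : ℤ)) ∧ Far (t * u) ∧ Far (t * p) := by
  obtain ⟨u', hu'⟩ := Int.gcd_dvd_left u g
  obtain ⟨g', hg'⟩ := Int.gcd_dvd_right u g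
  have h0 : 0 < Int.gcd u g := Int.gcd_pos_of_ne_zero_left _ hup.ne'
  have h1 : Int.gcd u g ≠ 1 := fun h => hu (Int.isCoprime_iff_gcd_eq_one.mpr h)
  have hcd : IsCoprime p (Int.gcd u g : ℤ) := isCoprime_of fun d h2 h3 =>
    H d (h3.trans (Int.gcd_dvd_right u g)) (h3.trans (Int.gcd_dvd_left u g)) h2
  have hd : (0 : ℤ) < Int.gcd u g := by exact_mod_cast h0
  have hd2 : (2 : ℤ) ≤ Int.gcd u g := by omega
  generalize (Int.gcd u g : ℤ) = d at *
  subst hu' hg'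
  have hg'p : 0 < g' := pos_of_mul_pos_right (show 0 < d * g' by omega) hd.le
  obtain ⟨t, h2, h3, h4, h5⟩ := triple_shift d (g' * a) (g' * b) u' p hd2 (by positivity)
    (by positivity) (pos_of_mul_pos_right hup hd.le) hcd
  rw [← mul_assoc] at h2 h3
  exact ⟨t, h2, h3, h4, h5⟩

lemma main_pair (g a b u p : ℤ) (hg : 4 ≤ g) (ha : 0 < a) (hb : 0 < b) (hup : 0 < u)
    (hpp : 0 < p) (hco : IsCoprime a b) (H : ∀ d : ℤ, d ∣ g → d ∣ u → d ∣ p → IsUnit d) :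
    ∃ t : ℝ, Far (t * (g * a : ℤ)) ∧ Far (t * (g * b : ℤ)) ∧ Far (t * u) ∧ Far (t * p) := by
  by_cases hu : IsCoprime u g
  swap
  · exact triple_shift' g a b u p hg ha hb hup H hu
  by_cases hp : IsCoprime p g
  swap
  · obtain ⟨t, h1, h2, h3, h4⟩ := triple_shift' g a b p u hg ha hb hpp
      (fun d x y z => H d x z y) hp
    exact ⟨t, h1, h2, h4, h3⟩
  by_cases hm : g ∣ p - u
  · exact main_two g a b u p hg ha hb hco hu hp hm
  by_cases hm' : g ∣ p + u
  · obtain ⟨t, h1, h2, h3, h4⟩ := main_two g a b u (-p) hg ha hb hco hu hp.neg_left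
      (by obtain ⟨l, hl⟩ := hm'; exact ⟨-l, by linarith⟩)
    exact ⟨t, h1, h2, h3, h4.congr_neg 0 (by push_cast; ring)⟩
  have hg' : (4 : ℝ) ≤ g := by exact_mod_cast hg
  have hg0 : (g : ℝ) ≠ 0 := by linarith
  obtain ⟨t, h1, h2, h3⟩ := lr3 a b u ha hb hup
  have np : ¬ g ∣ p := by
    intro hd
    have := hp.isUnit_of_dvd' hd dvd_rfl
    rw [Int.isUnit_iff] at this
    omega
  obtain ⟨k, h4, h5⟩ := claimC2 g u p hg hu np hm hm' (t / g * u) (t / g * p) (Or.inr (by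
    convert h3 using 1; field_simp))
  refine ⟨(t + k) / g, h1.congr (k * a) ?_, h2.congr (k * b) ?_, h4.congr 0 ?_, h5.congr 0 ?_⟩ <;>
  · push_cast; field_simp; try ring

lemma main_nat (v₁ v₂ v₃ v₄ : ℕ) (h₁ : 0 < v₁) (h₂ : 0 < v₂) (h₃ : 0 < v₃) (h₄ : 0 < v₄)
    (hgcd : Nat.gcd (Nat.gcd (Nat.gcd v₁ v₂) v₃) v₄ = 1) (hpair : 3 < Nat.gcd v₁ v₂) :
    ∃ t : ℝ, Far (t * v₁) ∧ Far (t * v₂) ∧ Far (t * v₃) ∧ Far (t * v₄) := by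
  obtain ⟨a, b, hco, ha, hb⟩ := Nat.exists_coprime v₁ v₂
  rw [mul_comm] at ha hb
  generalize hgg : Nat.gcd v₁ v₂ = g at *
  have ha0 : 0 < a := Nat.pos_of_ne_zero (by rintro rfl; simp at ha; omega)
  have hb0 : 0 < b := Nat.pos_of_ne_zero (by rintro rfl; simp at hb; omega)
  obtain ⟨t, x1, x2, x3, x4⟩ := main_pair g a b v₃ v₄ (by omega) (by omega) (by omega) (by omega)
    (by omega) (Nat.isCoprime_iff_coprime.mpr hco) (by
      intro d d1 d2 d3
      rw [Int.isUnit_iff_natAbs_eq]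
      rw [Int.dvd_natCast] at d1 d2 d3
      exact Nat.dvd_one.mp (hgcd ▸ Nat.dvd_gcd (Nat.dvd_gcd d1 d2) d3))
  refine ⟨t, ?_, ?_, by simpa using x3, by simpa using x4⟩
  · rw [ha]; simpa using x1
  · rw [hb]; simpa using x2

lemma main_all (v₁ v₂ v₃ v₄ : ℕ) (h₁ : 0 < v₁) (h₂ : 0 < v₂) (h₃ : 0 < v₃) (h₄ : 0 < v₄)
    (hgcd : Nat.gcd (Nat.gcd (Nat.gcd v₁ v₂) v₃) v₄ = 1)
    (hpair : 3 < Nat.gcd v₁ v₂ ∨ 3 < Nat.gcd v₁ v₃ ∨ 3 < Nat.gcd v₁ v₄ ∨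
      3 < Nat.gcd v₂ v₃ ∨ 3 < Nat.gcd v₂ v₄ ∨ 3 < Nat.gcd v₃ v₄) :
    ∃ t : ℝ, Far (t * v₁) ∧ Far (t * v₂) ∧ Far (t * v₃) ∧ Far (t * v₄) := by
  rcases hpair with h | h | h | h | h | h
  · exact main_nat v₁ v₂ v₃ v₄ h₁ h₂ h₃ h₄ hgcd h
  · obtain ⟨t, x1, x2, x3, x4⟩ := main_nat v₁ v₃ v₂ v₄ h₁ h₃ h₂ h₄
      (by rw [← hgcd]; ac_rfl) h
    exact ⟨t, x1, x3, x2, x4⟩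
  · obtain ⟨t, x1, x2, x3, x4⟩ := main_nat v₁ v₄ v₂ v₃ h₁ h₄ h₂ h₃
      (by rw [← hgcd]; ac_rfl) h
    exact ⟨t, x1, x3, x4, x2⟩
  · obtain ⟨t, x1, x2, x3, x4⟩ := main_nat v₂ v₃ v₁ v₄ h₂ h₃ h₁ h₄
      (by rw [← hgcd]; ac_rfl) h
    exact ⟨t, x3, x1, x2, x4⟩
  · obtain ⟨t, x1, x2, x3, x4⟩ := main_nat v₂ v₄ v₁ v₃ h₂ h₄ h₁ h₃
      (by rw [← hgcd]; ac_rfl) h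
    exact ⟨t, x3, x1, x4, x2⟩
  · obtain ⟨t, x1, x2, x3, x4⟩ := main_nat v₃ v₄ v₁ v₂ h₃ h₄ h₁ h₂
      (by rw [← hgcd]; ac_rfl) h
    exact ⟨t, x3, x4, x1, x2⟩

lemma dnn_of_far {x : ℝ} (h : Far x) : 1 / 4 ≤ dnn x := by
  obtain ⟨m, h1, h2⟩ := h
  refine le_ciInf fun n => ?_
  rcases le_or_gt n m with h | h
  · have : (n : ℝ) ≤ m := by exact_mod_cast h
    exact le_trans (by linarith) (le_abs_self _)
  · have : (m : ℝ) + 1 ≤ n := by exact_mod_cast h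
    exact le_trans (by linarith) (neg_le_abs _)

lemma dnn_le (x : ℝ) : dnn x ≤ 1 / 2 :=
  (ciInf_le ⟨0, by rintro _ ⟨m, rfl⟩; exact abs_nonneg _⟩ (round x)).trans (abs_sub_round x)

theorem stmt_10 (v₁ v₂ v₃ v₄ : ℕ) (h₁ : 0 < v₁) (h₂ : 0 < v₂) (h₃ : 0 < v₃) (h₄ : 0 < v₄)
    (hgcd : Nat.gcd (Nat.gcd (Nat.gcd v₁ v₂) v₃) v₄ = 1)
    (hpair : 3 < Nat.gcd v₁ v₂ ∨ 3 < Nat.gcd v₁ v₃ ∨ 3 < Nat.gcd v₁ v₄ ∨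
      3 < Nat.gcd v₂ v₃ ∨ 3 < Nat.gcd v₂ v₄ ∨ 3 < Nat.gcd v₃ v₄) :
    ML ![(v₁ : ℝ), (v₂ : ℝ), (v₃ : ℝ), (v₄ : ℝ)] ≥ 1 / 4 := by
  obtain ⟨t, x1, x2, x3, x4⟩ := main_all v₁ v₂ v₃ v₄ h₁ h₂ h₃ h₄ hgcd hpair
  have hb : BddAbove (Set.range fun t : ℝ =>
      ⨅ i, dnn (t * ![(v₁ : ℝ), (v₂ : ℝ), (v₃ : ℝ), (v₄ : ℝ)] i)) := by
    refine ⟨1 / 2, ?_⟩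
    rintro _ ⟨s, rfl⟩
    exact (ciInf_le (Set.finite_range _).bddBelow 0).trans (dnn_le _)
  refine le_trans ?_ (le_ciSup hb t)
  refine le_ciInf fun i => ?_
  fin_cases i
  · exact dnn_of_far x1
  · exact dnn_of_far x2
  · exact dnn_of_far x3
  · exact dnn_of_far x4
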